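/- In the model-based fictitious play under Assumption 1, suppose for i = 1,2 the family Q*_i = (Q*_{i,s})_{s∈S} of A1×A2 matrices is a fixed point of the Shapley operator, i.e., Q*_{i,s} = R_{i,s} + γ Σ_{s'∈S} val_i(Q*_{i,s'}) P_{s'|s} for all s ∈ S. Then for every s ∈ S and each i ∈ {1,2}: lim_{k→∞} ‖Q̂_{i,s,k} − Q*_{i,s}‖_max = 0. -/

import Mathlib

open Finset Filter Topology

/-- Model-based fictitious play in a finite two-player zero-sum stochastic game. -/
structure MBFP (S A1 A2 : Type) [Fintype S] [Fintype A1] [Fintype A2]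
    [Nonempty S] [Nonempty A1] [Nonempty A2]
    [DecidableEq S] [DecidableEq A1] [DecidableEq A2] where
  /-- stage payoff of player 1 -/
  r1 : S → A1 → A2 → ℝ
  /-- stage payoff of player 2 -/
  r2 : S → A1 → A2 → ℝ
  /-- transition probabilities: `p s a b s'` is the probability of moving to `s'` -/
  p : S → A1 → A2 → S → ℝ
  /-- discount factor -/
  γ : ℝ
  zerosum : ∀ s a b, r1 s a b + r2 s a b = 0
  p_nonneg : ∀ s a b s', 0 ≤ p s a b s'
  p_sum_one : ∀ s a b, ∑ s', p s a b s' = 1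
  γ_nonneg : 0 ≤ γ
  γ_lt_one : γ < 1
  /-- the realized state sequence -/
  st : ℕ → S
  /-- step sizes for beliefs on strategies -/
  α : ℕ → ℝ
  /-- step sizes for beliefs on Q-functions -/
  β : ℕ → ℝ
  α_mem : ∀ c, α c ∈ Set.Ioc (0:ℝ) 1
  β_mem : ∀ c, β c ∈ Set.Ioc (0:ℝ) 1
  /-- belief (held by player 2) on player 1's mixed action at each state -/
  π1 : S → ℕ → A1 → ℝ
  /-- belief (held by player 1) on player 2's mixed action at each state -/
  π2 : S → ℕ → A2 → ℝ
  /-- player 1's belief on its own Q-function -/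
  Q1 : S → ℕ → A1 → A2 → ℝ
  /-- player 2's belief on its own Q-function -/
  Q2 : S → ℕ → A1 → A2 → ℝ
  /-- best-response action of player 1 at stage k -/
  astar1 : ℕ → A1
  /-- best-response action of player 2 at stage k -/
  astar2 : ℕ → A2
  π1_simplex : ∀ s k, π1 s k ∈ stdSimplex ℝ A1
  π2_simplex : ∀ s k, π2 s k ∈ stdSimplex ℝ A2
  Q1_init : ∀ s, Q1 s 0 = r1 s
  Q2_init : ∀ s, Q2 s 0 = r2 s
  astar1_br : ∀ k b,
    ∑ b2, Q1 (st k) k b b2 * π2 (st k) k b2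
      ≤ ∑ b2, Q1 (st k) k (astar1 k) b2 * π2 (st k) k b2
  astar2_br : ∀ k b,
    ∑ b1, π1 (st k) k b1 * Q2 (st k) k b1 b
      ≤ ∑ b1, π1 (st k) k b1 * Q2 (st k) k b1 (astar2 k)
  π1_upd : ∀ s k, π1 s (k+1) = fun b =>
    π1 s k b + (if s = st k then α (((Finset.range k).filter fun k' => st k' = s).card) else 0)
      * ((if b = astar1 k then (1:ℝ) else 0) - π1 s k b)
  π2_upd : ∀ s k, π2 s (k+1) = fun b =>
    π2 s k b + (if s = st k then α (((Finset.range k).filter fun k' => st k' = s).card) else 0)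
      * ((if b = astar2 k then (1:ℝ) else 0) - π2 s k b)
  Q1_upd : ∀ s k, Q1 s (k+1) = fun b1 b2 =>
    Q1 s k b1 b2
      + (if s = st k then β (((Finset.range k).filter fun k' => st k' = s).card) else 0)
        * (r1 s b1 b2
          + γ * ∑ s', (Finset.univ.sup' Finset.univ_nonempty fun c1 =>
              ∑ b2', Q1 s' k c1 b2' * π2 s' k b2') * p s b1 b2 s'
          - Q1 s k b1 b2)
  Q2_upd : ∀ s k, Q2 s (k+1) = fun b1 b2 =>
    Q2 s k b1 b2
      + (if s = st k then β (((Finset.range k).filter fun k' => st k' = s).card) else 0)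
        * (r2 s b1 b2
          + γ * ∑ s', (Finset.univ.sup' Finset.univ_nonempty fun c2 =>
              ∑ b1', π1 s' k b1' * Q2 s' k b1' c2) * p s b1 b2 s'
          - Q2 s k b1 b2)

variable {S A1 A2 : Type} [Fintype S] [Fintype A1] [Fintype A2]
    [Nonempty S] [Nonempty A1] [Nonempty A2]
    [DecidableEq S] [DecidableEq A1] [DecidableEq A2]

/-- the largest absolute value of an entry of a matrix -/
noncomputable def maxNorm (Q : A1 → A2 → ℝ) : ℝ :=
  Finset.univ.sup' Finset.univ_nonempty fun q : A1 × A2 => |Q q.1 q.2|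

namespace MBFP

/-- the number of visits to state `s` before stage `k` -/
def cnt (G : MBFP S A1 A2) (s : S) (k : ℕ) : ℕ :=
  ((Finset.range k).filter fun k' => G.st k' = s).card

/-- player 1's estimate of its continuation payoff at state `s` -/
noncomputable def vhat1 (G : MBFP S A1 A2) (k : ℕ) (s : S) : ℝ :=
  Finset.univ.sup' Finset.univ_nonempty fun b1 => ∑ b2, G.Q1 s k b1 b2 * G.π2 s k b2

/-- player 2's estimate of its continuation payoff at state `s` -/
noncomputable def vhat2 (G : MBFP S A1 A2) (k : ℕ) (s : S) : ℝ :=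
  Finset.univ.sup' Finset.univ_nonempty fun b2 => ∑ b1, G.π1 s k b1 * G.Q2 s k b1 b2

/-- Assumption 1 of the paper -/
def Assumption1 (G : MBFP S A1 A2) : Prop :=
  (∀ s, Tendsto (fun k => G.cnt s k) atTop atTop) ∧
  Tendsto (fun n => ∑ c ∈ Finset.range n, G.α c) atTop atTop ∧
  Tendsto (fun n => ∑ c ∈ Finset.range n, G.β c) atTop atTop ∧
  Tendsto G.α atTop (𝓝 0) ∧
  Tendsto G.β atTop (𝓝 0) ∧
  Tendsto (fun c => G.β c / G.α c) atTop (𝓝 0)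

end MBFP

/-- the minimax value `val₁(Q) = min_{π2 ∈ Δ(A2)} max_{a1 ∈ A1} a1ᵀ Q π2` -/
noncomputable def val1 (Q : A1 → A2 → ℝ) : ℝ :=
  sInf ((fun q2 : A2 → ℝ =>
    Finset.univ.sup' Finset.univ_nonempty fun b1 => ∑ b2, Q b1 b2 * q2 b2) '' stdSimplex ℝ A2)

/-- the minimax value `val₂(Q) = min_{π1 ∈ Δ(A1)} max_{a2 ∈ A2} π1ᵀ Q a2` -/
noncomputable def val2 (Q : A1 → A2 → ℝ) : ℝ :=
  sInf ((fun q1 : A1 → ℝ =>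
    Finset.univ.sup' Finset.univ_nonempty fun b2 => ∑ b1, q1 b1 * Q b1 b2) '' stdSimplex ℝ A1)

open MeasureTheory

set_option linter.unusedSectionVars false

theorem le_zero_of_deriv_le_neg {g : ℝ → ℝ} {K : NNReal} {B : ℝ} (hg : LipschitzWith K g)
    (hd : ∀ᵐ t, ∀ d, HasDerivAt g d t → d ≤ -g t) (hB : ∀ t, g t ≤ B) : g 0 ≤ 0 := by
  have key : ∀ t : ℝ, t ≤ 0 → g 0 ≤ Real.exp t * B := by
    intro t ht
    have h1 : AbsolutelyContinuousOnInterval (fun x => Real.exp x * g x) t 0 :=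
      AbsolutelyContinuousOnInterval.fun_mul
        (Real.contDiff_exp.contDiffOn.absolutelyContinuousOnInterval)
        hg.lipschitzOnWith.absolutelyContinuousOnInterval
    have h2 := h1.integral_deriv_eq_sub
    have h3 : ∀ᵐ x, 0 ≤ - deriv (fun x => Real.exp x * g x) x := by
      filter_upwards [hd, hg.ae_differentiableAt_real] with x hx hdx
      have := ((Real.hasDerivAt_exp x).mul hdx.hasDerivAt).deriv
      rw [show (fun x => Real.exp x * g x) = Real.exp * g from rfl, this]
      nlinarith [hx _ hdx.hasDerivAt, Real.exp_pos x]
    have h4 : 0 ≤ ∫ x in t..0, - deriv (fun x => Real.exp x * g x) x :=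
      intervalIntegral.integral_nonneg_of_ae ht h3
    rw [intervalIntegral.integral_neg, h2, Real.exp_zero] at h4
    nlinarith [Real.exp_pos t, hB t]
  have hlim : Tendsto (fun t => Real.exp t * B) atBot (𝓝 (0 * B)) :=
    Real.tendsto_exp_atBot.mul_const B
  rw [zero_mul] at hlim
  exact ge_of_tendsto hlim ((eventually_le_atBot 0).mono key)

theorem exists_time_index {τ : ℕ → ℝ} (hmono : Monotone τ) (htop : Tendsto τ atTop atTop)
    (hstep : Tendsto (fun n => τ (n + 1) - τ n) atTop (𝓝 0)) (t : ℝ) :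
    ∃ idx : ℕ → ℕ, Tendsto idx atTop atTop ∧
      Tendsto (fun n => τ (idx n) - τ n) atTop (𝓝 t) := by
  classical
  have hex : ∀ n, ∃ m, τ n + t ≤ τ m := fun n => (htop.eventually_ge_atTop _).exists
  have hidx : Tendsto (fun n => Nat.find (hex n)) atTop atTop := by
    refine tendsto_atTop.2 fun N => ?_
    filter_upwards [htop.eventually_gt_atTop (τ N - t)] with n hn
    by_contra! hlt
    have h1 := Nat.find_spec (hex n)
    have h2 := hmono hlt.le
    linarith
  refine ⟨_, hidx, ?_⟩
  have hup : Tendsto (fun n => t + (τ (Nat.find (hex n) - 1 + 1) - τ (Nat.find (hex n) - 1)))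
      atTop (𝓝 (t + 0)) :=
    (hstep.comp ((tendsto_sub_atTop_nat 1).comp hidx)).const_add t
  rw [add_zero] at hup
  refine tendsto_of_tendsto_of_tendsto_of_le_of_le' tendsto_const_nhds hup
    (Eventually.of_forall fun n => ?_) ?_
  · have := Nat.find_spec (hex n)
    linarith
  · filter_upwards [hidx.eventually_ge_atTop 1] with n hn
    have h1 := Nat.find_min (hex n) (m := Nat.find (hex n) - 1) (by omega)
    rw [Nat.sub_add_cancel hn]
    linarith

theorem sub_le_of_forall_increment_le {z τ : ℕ → ℝ} {A : ℝ} {m m' : ℕ} (hm : m ≤ m')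
    (h : ∀ c, m ≤ c → c < m' → z (c + 1) - z c ≤ A * (τ (c + 1) - τ c)) :
    z m' - z m ≤ A * (τ m' - τ m) := by
  induction m', hm using Nat.le_induction with
  | base => simp
  | succ n hn ih =>
    have h1 := ih fun c h1 h2 => h c h1 (by omega)
    have h2 := h n hn (by omega)
    linarith

theorem abs_sub_le_of_forall_increment_le {z τ : ℕ → ℝ} {K : ℝ} {N : ℕ}
    (h : ∀ c, N ≤ c → |z (c + 1) - z c| ≤ K * (τ (c + 1) - τ c)) {m m' : ℕ}
    (hτ : Monotone τ) (hm : N ≤ m) (hm' : N ≤ m') : |z m' - z m| ≤ K * |τ m' - τ m| := by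
  wlog hle : m ≤ m' generalizing m m'
  · rw [abs_sub_comm, abs_sub_comm (τ m')]
    exact this hm' hm (by omega)
  rw [abs_of_nonneg (sub_nonneg.2 (hτ hle)), abs_le]
  constructor
  · have := sub_le_of_forall_increment_le (z := fun c => - z c) (τ := τ) (A := K) hle
      fun c h1 _ => by have := (abs_le.1 (h c (by omega))).1; linarith
    linarith
  · exact sub_le_of_forall_increment_le hle
      fun c h1 _ => (abs_le.1 (h c (by omega))).2

theorem deriv_le_of_forall_increment_le {f : ℝ → ℝ} {d t A : ℝ} (hf : HasDerivAt f d t)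
    (h : ∀ᶠ u in 𝓝[>] (0 : ℝ), f (t + u) - f t ≤ (A + u) * u) : d ≤ A := by
  have h1 := (hasDerivAt_iff_tendsto_slope_zero.1 hf).mono_left
    (nhdsWithin_mono (s := Set.Ioi 0) (0 : ℝ) (fun u (hu : 0 < u) => hu.ne'))
  have h2 : Tendsto (fun u : ℝ => A + u) (𝓝[>] 0) (𝓝 (A + 0)) :=
    (tendsto_id.mono_left nhdsWithin_le_nhds).const_add A
  rw [add_zero] at h2
  refine le_of_tendsto_of_tendsto h1 h2 ?_
  filter_upwards [h, self_mem_nhdsWithin] with u hu hpos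
  rw [smul_eq_mul, inv_mul_le_iff₀ hpos]
  linarith

theorem exists_tendsto_ultrafilter {ι : Type*} (U : Ultrafilter ι) {z : ι → ℝ} {B : ℝ}
    (h : ∀ n, |z n| ≤ B) : ∃ l, Tendsto z U (𝓝 l) := by
  obtain ⟨l, -, hl⟩ := (isCompact_Icc (a := -B) (b := B)).ultrafilter_le_nhds (U.map z)
    (le_principal_iff.2 (Filter.mem_map.2 (Filter.univ_mem' fun n => abs_le.1 (h n))))
  exact ⟨l, hl⟩

theorem abs_sup'_sub_sup'_le {ι : Type*} [Fintype ι] [Nonempty ι] {f g : ι → ℝ} {K : ℝ}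
    (h : ∀ i, |f i - g i| ≤ K) :
    |univ.sup' univ_nonempty f - univ.sup' univ_nonempty g| ≤ K := by
  have aux : ∀ f g : ι → ℝ, (∀ i, |f i - g i| ≤ K) →
      univ.sup' univ_nonempty f ≤ univ.sup' univ_nonempty g + K := fun f g h =>
    sup'_le _ _ fun i _ => by
      have h1 := le_sup' g (mem_univ i)
      have h2 := (abs_le.1 (h i)).2
      linarith
  have h1 := aux f g h
  have h2 := aux g f fun i => by rw [abs_sub_comm]; exact h i
  rw [abs_le]
  constructor <;> linarith

theorem abs_le_maxNorm (Q : A1 → A2 → ℝ) (i : A1) (j : A2) : |Q i j| ≤ maxNorm Q :=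
  le_sup' (fun q : A1 × A2 => |Q q.1 q.2|) (mem_univ (i, j))

theorem maxNorm_le {Q : A1 → A2 → ℝ} {M : ℝ} (h : ∀ i j, |Q i j| ≤ M) : maxNorm Q ≤ M :=
  sup'_le _ _ fun q _ => h q.1 q.2

theorem maxNorm_nonneg (Q : A1 → A2 → ℝ) : 0 ≤ maxNorm Q :=
  (abs_nonneg _).trans (abs_le_maxNorm Q (Classical.arbitrary A1) (Classical.arbitrary A2))

theorem tendsto_maxNorm {ι : Type*} {l : Filter ι} {Q : ι → A1 → A2 → ℝ} {Q' : A1 → A2 → ℝ}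
    (h : ∀ i j, Tendsto (fun n => Q n i j) l (𝓝 (Q' i j))) :
    Tendsto (fun n => maxNorm (Q n)) l (𝓝 (maxNorm Q')) :=
  Tendsto.finset_sup'_nhds_apply univ_nonempty fun q _ => (h q.1 q.2).abs

/-- `x` is the running weighted average, with step sizes the increments of the clock `τ`, of actions
`a` that maximize the scores `F` whenever the clock moves. -/
structure IsReplyPath {A : Type*} [Fintype A] [DecidableEq A] (τ : ℕ → ℝ) (x : ℕ → A → ℝ)
    (a : ℕ → A) (F : ℕ → A → ℝ) : Prop where
  simplex : ∀ k, x k ∈ stdSimplex ℝ A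
  upd : ∀ k i, x (k + 1) i =
    x k i + (τ (k + 1) - τ k) * ((if i = a k then (1 : ℝ) else 0) - x k i)
  reply : ∀ k, τ (k + 1) ≠ τ k → ∀ i, F k i ≤ F k (a k)

namespace IsReplyPath

variable {A : Type*} [Fintype A] [DecidableEq A] {τ : ℕ → ℝ} {x : ℕ → A → ℝ} {a : ℕ → A}
  {F : ℕ → A → ℝ}

theorem nonneg (h : IsReplyPath τ x a F) (k : ℕ) (i : A) : 0 ≤ x k i := (h.simplex k).1 i

theorem le_one (h : IsReplyPath τ x a F) (k : ℕ) (i : A) : x k i ≤ 1 := by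
  rw [← (h.simplex k).2]
  exact single_le_sum (fun i _ => h.nonneg k i) (mem_univ i)

theorem abs_increment_le (h : IsReplyPath τ x a F) (hτ : Monotone τ) (k : ℕ) (i : A) :
    |x (k + 1) i - x k i| ≤ τ (k + 1) - τ k := by
  have h0 : 0 ≤ τ (k + 1) - τ k := sub_nonneg.2 (hτ k.le_succ)
  have h1 : |(if i = a k then (1 : ℝ) else 0) - x k i| ≤ 1 := by
    have := h.nonneg k i
    have := h.le_one k i
    rw [abs_le]; split_ifs <;> constructor <;> linarith
  rw [h.upd, add_sub_cancel_left, abs_mul, abs_of_nonneg h0]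
  exact mul_le_of_le_one_right h0 h1

theorem abs_sub_le (h : IsReplyPath τ x a F) (hτ : Monotone τ) (m m' : ℕ) (i : A) :
    |x m' i - x m i| ≤ |τ m' - τ m| := by
  simpa using abs_sub_le_of_forall_increment_le (z := fun k => x k i) (K := 1) (N := 0)
    (fun c _ => by simpa using h.abs_increment_le hτ c i) hτ m.zero_le m'.zero_le

section Limit

variable {U : Filter ℕ} [U.NeBot] {idx : ℝ → ℕ → ℕ} {xl : ℝ → A → ℝ}

theorem _root_.tendsto_clock_sub
    (hidx : ∀ t, Tendsto (fun n => τ (idx t n) - τ n) U (𝓝 t)) (t u : ℝ) :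
    Tendsto (fun n => τ (idx u n) - τ (idx t n)) U (𝓝 (u - t)) := by
  simpa using (hidx u).sub (hidx t)

theorem _root_.eventually_index_le (hτ : Monotone τ)
    (hidx : ∀ t, Tendsto (fun n => τ (idx t n) - τ n) U (𝓝 t)) {t u : ℝ} (htu : t < u) :
    ∀ᶠ n in U, idx t n ≤ idx u n := by
  filter_upwards [(tendsto_clock_sub hidx t u).eventually_const_lt (sub_pos.2 htu)] with n hn
  by_contra! hlt
  have := hτ hlt.le
  linarith

theorem deriv_add_nonneg (h : IsReplyPath τ x a F) (hτ : Monotone τ)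
    (hidx : ∀ t, Tendsto (fun n => τ (idx t n) - τ n) U (𝓝 t))
    (hxl : ∀ t i, Tendsto (fun n => x (idx t n) i) U (𝓝 (xl t i)))
    {t d : ℝ} {i : A} (hd : HasDerivAt (fun t => xl t i) d t) : 0 ≤ d + xl t i := by
  suffices -d ≤ xl t i by linarith
  refine deriv_le_of_forall_increment_le hd.neg ?_
  filter_upwards [self_mem_nhdsWithin] with u hu
  have hu : t < t + u := lt_add_of_pos_right t hu
  have hgap := tendsto_clock_sub hidx t (t + u)
  rw [add_sub_cancel_left] at hgap
  refine le_of_tendsto_of_tendsto ((hxl (t + u) i).neg.sub (hxl t i).neg)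
    (((hxl t i).add hgap).mul hgap) ?_
  filter_upwards [eventually_index_le hτ hidx hu] with n hn
  refine sub_le_of_forall_increment_le (z := fun c => - x c i) hn fun c h1 h2 => ?_
  have h3 := (abs_le.1 (h.abs_sub_le hτ (idx t n) c i)).2
  rw [abs_of_nonneg (sub_nonneg.2 (hτ h1))] at h3
  have h4 := hτ h2.le
  have h5 : 0 ≤ τ (c + 1) - τ c := sub_nonneg.2 (hτ c.le_succ)
  have h6 : x c i - (if i = a c then (1 : ℝ) else 0) ≤
      x (idx t n) i + (τ (idx (t + u) n) - τ (idx t n)) := by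
    split_ifs <;> linarith
  have h7 := mul_le_mul_of_nonneg_right h6 h5
  rw [h.upd]
  linarith

theorem deriv_add_eq_zero (h : IsReplyPath τ x a F) (hτ : Monotone τ)
    (hidx : ∀ t, Tendsto (fun n => τ (idx t n) - τ n) U (𝓝 t))
    (hxl : ∀ t i, Tendsto (fun n => x (idx t n) i) U (𝓝 (xl t i))) {K : ℝ}
    (hF : ∀ c i, |F (c + 1) i - F c i| ≤ K * (τ (c + 1) - τ c)) {t d : ℝ} {Fl : A → ℝ}
    (hFl : ∀ i, Tendsto (fun n => F (idx t n) i) U (𝓝 (Fl i))) {i i' : A} (hlt : Fl i < Fl i')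
    (hd : HasDerivAt (fun t => xl t i) d t) : d + xl t i = 0 := by
  refine le_antisymm ?_ (h.deriv_add_nonneg hτ hidx hxl hd)
  suffices d ≤ - xl t i by linarith
  refine deriv_le_of_forall_increment_le hd ?_
  have hsmall : Tendsto (fun u => Fl i - Fl i' + 2 * (|K| * u)) (𝓝[>] 0)
      (𝓝 (Fl i - Fl i' + 2 * (|K| * 0))) :=
    (((tendsto_id.mono_left nhdsWithin_le_nhds).const_mul |K|).const_mul 2).const_add _
  filter_upwards [self_mem_nhdsWithin,
    hsmall.eventually_lt_const (u := 0) (by linarith)] with u hu hneg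
  have hu : t < t + u := lt_add_of_pos_right t hu
  have hgap := tendsto_clock_sub hidx t (t + u)
  rw [add_sub_cancel_left] at hgap
  refine le_of_tendsto_of_tendsto ((hxl (t + u) i).sub (hxl t i))
    (((hxl t i).neg.add hgap).mul hgap) ?_
  filter_upwards [eventually_index_le hτ hidx hu, ((((hFl i).sub (hFl i')).add
    ((hgap.const_mul |K|).const_mul 2))).eventually_lt_const hneg] with n hn hnF
  refine sub_le_of_forall_increment_le (z := fun c => x c i) hn fun c h1 h2 => ?_
  have hτc : τ (idx t n) ≤ τ c := hτ h1
  have hτc' : τ c ≤ τ (idx (t + u) n) := hτ h2.le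
  have hFc : ∀ i, |F c i - F (idx t n) i| ≤ |K| * (τ (idx (t + u) n) - τ (idx t n)) := by
    intro i
    have := abs_sub_le_of_forall_increment_le (z := fun k => F k i) (K := K) (N := 0)
      (fun c _ => hF c i) hτ (idx t n).zero_le c.zero_le
    rw [abs_of_nonneg (sub_nonneg.2 hτc)] at this
    refine this.trans ((mul_le_mul_of_nonneg_right (le_abs_self K) (by linarith)).trans ?_)
    exact mul_le_mul_of_nonneg_left (by linarith) (abs_nonneg K)
  have hFi := (abs_le.1 (hFc i)).2
  have hFi' := (abs_le.1 (hFc i')).1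
  have h5 : 0 ≤ τ (c + 1) - τ c := sub_nonneg.2 (hτ c.le_succ)
  rcases h5.eq_or_lt with h6 | h6
  · have := h.abs_increment_le hτ c i
    rw [← h6] at this ⊢
    rw [mul_zero]
    exact (abs_le.1 this).2
  · have hne : i ≠ a c := by
      rintro rfl
      have := h.reply c (by linarith) i'
      linarith
    have h3 := (abs_le.1 (h.abs_sub_le hτ (idx t n) c i)).1
    rw [abs_of_nonneg (sub_nonneg.2 hτc)] at h3
    rw [h.upd, if_neg hne]
    have h8 : 0 - x c i ≤ -x (idx t n) i + (τ (idx (t + u) n) - τ (idx t n)) := by linarith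
    have h7 := mul_le_mul_of_nonneg_right h8 h5
    linarith

theorem sum_deriv_add_eq_one (h : IsReplyPath τ x a F)
    (hxl : ∀ t i, Tendsto (fun n => x (idx t n) i) U (𝓝 (xl t i)))
    {t : ℝ} {d : A → ℝ} (hd : ∀ i, HasDerivAt (fun t => xl t i) (d i) t) :
    ∑ i, (d i + xl t i) = 1 := by
  have h1 : ∀ t, ∑ i, xl t i = 1 := fun t =>
    tendsto_nhds_unique (tendsto_finsetSum _ fun i _ => hxl t i)
      (by simp only [(h.simplex _).2]; exact tendsto_const_nhds)
  have h2 : HasDerivAt (fun t => ∑ i, xl t i) (∑ i, d i) t := HasDerivAt.fun_sum fun i _ => hd i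
  simp only [h1] at h2
  rw [sum_add_distrib, h1, h2.unique (hasDerivAt_const t (1 : ℝ)), zero_add]

theorem value_deriv_add {B : Type*} [Fintype B] [Nonempty A] {y : ℕ → B → ℝ}
    {P : ℕ → A → B → ℝ} (h : IsReplyPath τ x a fun c i => ∑ j, P c i j * y c j) (hτ : Monotone τ)
    (hidx : ∀ t, Tendsto (fun n => τ (idx t n) - τ n) U (𝓝 t))
    (hxl : ∀ t i, Tendsto (fun n => x (idx t n) i) U (𝓝 (xl t i))) {K : ℝ}
    (hF : ∀ c i, |∑ j, P (c + 1) i j * y (c + 1) j - ∑ j, P c i j * y c j|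
      ≤ K * (τ (c + 1) - τ c))
    {yl : ℝ → B → ℝ} {Pl : A → B → ℝ}
    (hyl : ∀ t j, Tendsto (fun n => y (idx t n) j) U (𝓝 (yl t j)))
    (hPl : ∀ t i j, Tendsto (fun n => P (idx t n) i j) U (𝓝 (Pl i j)))
    {t dv : ℝ} {d : A → ℝ} {e : B → ℝ} (hd : ∀ i, HasDerivAt (fun t => xl t i) (d i) t)
    (he : ∀ j, HasDerivAt (fun t => yl t j) (e j) t)
    (hv : HasDerivAt (fun t => univ.sup' univ_nonempty fun i => ∑ j, Pl i j * yl t j) dv t) :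
    dv + univ.sup' univ_nonempty (fun i => ∑ j, Pl i j * yl t j) =
      ∑ i, (d i + xl t i) * ∑ j, Pl i j * (e j + yl t j) := by
  rw [← one_mul (dv + _), ← h.sum_deriv_add_eq_one hxl hd, sum_mul]
  refine sum_congr rfl fun i _ => ?_
  by_cases hi : ∃ i', ∑ j, Pl i j * yl t j < ∑ j, Pl i' j * yl t j
  · obtain ⟨i', hi'⟩ := hi
    rw [h.deriv_add_eq_zero hτ hidx hxl hF
      (Fl := fun i => ∑ j, Pl i j * yl t j)
      (fun i => tendsto_finsetSum _ fun j _ => (hPl t i j).mul (hyl t j)) hi' (hd i)]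
    simp
  · push Not at hi
    have hmax : univ.sup' univ_nonempty (fun i => ∑ j, Pl i j * yl t j) = ∑ j, Pl i j * yl t j :=
      le_antisymm (sup'_le _ _ fun i' _ => hi i')
        (le_sup' (fun i => ∑ j, Pl i j * yl t j) (mem_univ i))
    have hder : HasDerivAt (fun t => ∑ j, Pl i j * yl t j) (∑ j, Pl i j * e j) t :=
      HasDerivAt.fun_sum fun j _ => (he j).const_mul _
    have hmin : IsLocalMin (fun t => univ.sup' univ_nonempty (fun i => ∑ j, Pl i j * yl t j) -
        ∑ j, Pl i j * yl t j) t := by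
      refine Eventually.of_forall fun u => ?_
      simp only [hmax, sub_self]
      exact sub_nonneg.2 (le_sup' (fun i => ∑ j, Pl i j * yl u j) (mem_univ i))
    have := hmin.hasDerivAt_eq_zero (hv.sub hder)
    rw [hmax, sub_eq_zero.1 this]
    simp only [mul_add, sum_add_distrib]

end Limit

end IsReplyPath

theorem abs_score_increment_le {A B : Type*} [Fintype B] [DecidableEq B] {τ ρ : ℕ → ℝ}
    {y : ℕ → B → ℝ} {b : ℕ → B} {F : ℕ → B → ℝ} (hy : IsReplyPath τ y b F) (hτ : Monotone τ)
    {P : ℕ → A → B → ℝ} {M R : ℝ} (hρ : ∀ c, ρ c ≤ R)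
    (hPM : ∀ c i j, |P c i j| ≤ M)
    (hP : ∀ c i j, |P (c + 1) i j - P c i j| ≤ ρ c * (τ (c + 1) - τ c)) (c : ℕ) (i : A) :
    |∑ j, P (c + 1) i j * y (c + 1) j - ∑ j, P c i j * y c j|
      ≤ (∑ _j : B, (R + M)) * (τ (c + 1) - τ c) := by
  rw [← sum_sub_distrib, sum_mul]
  refine (abs_sum_le_sum_abs _ _).trans (sum_le_sum fun j _ => ?_)
  have h0 : 0 ≤ τ (c + 1) - τ c := sub_nonneg.2 (hτ c.le_succ)
  have h1 : |(P (c + 1) i j - P c i j) * y (c + 1) j| ≤ R * (τ (c + 1) - τ c) := by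
    rw [abs_mul, abs_of_nonneg (hy.nonneg _ _)]
    calc _ ≤ |P (c + 1) i j - P c i j| * 1 :=
          mul_le_mul_of_nonneg_left (hy.le_one _ _) (abs_nonneg _)
      _ ≤ _ := by rw [mul_one]; exact (hP c i j).trans (mul_le_mul_of_nonneg_right (hρ c) h0)
  have h2 : |P c i j * (y (c + 1) j - y c j)| ≤ M * (τ (c + 1) - τ c) := by
    rw [abs_mul]
    exact mul_le_mul (hPM c i j) (hy.abs_increment_le hτ c j) (abs_nonneg _)
      ((abs_nonneg _).trans (hPM c i j))
  have h3 := abs_add_le ((P (c + 1) i j - P c i j) * y (c + 1) j) (P c i j * (y (c + 1) j - y c j))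
  rw [show P (c + 1) i j * y (c + 1) j - P c i j * y c j =
    (P (c + 1) i j - P c i j) * y (c + 1) j + P c i j * (y (c + 1) j - y c j) by ring]
  linarith

theorem tendsto_comp_index_of_drift {τ ρ z : ℕ → ℝ} {U : Filter ℕ} (hU : U ≤ atTop)
    (hτ : Monotone τ) (hρ : Tendsto ρ atTop (𝓝 0))
    (hz : ∀ c, |z (c + 1) - z c| ≤ ρ c * (τ (c + 1) - τ c)) {idx : ℕ → ℕ} {t l : ℝ}
    (hidx : Tendsto idx U atTop) (hidx' : Tendsto (fun n => τ (idx n) - τ n) U (𝓝 t))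
    (hl : Tendsto z U (𝓝 l)) : Tendsto (fun n => z (idx n)) U (𝓝 l) := by
  have hdiff : Tendsto (fun n => z (idx n) - z n) U (𝓝 0) := by
    rw [Metric.tendsto_nhds]
    intro ε hε
    have hpos : 0 < |t| + 1 := by positivity
    obtain ⟨N, hN⟩ := eventually_atTop.1 (hρ.eventually_lt_const (div_pos hε hpos))
    filter_upwards [hidx.eventually_ge_atTop N, hU (eventually_ge_atTop N),
      hidx'.abs.eventually_lt_const (lt_add_one |t|)] with n h1 h2 h3
    have h4 := abs_sub_le_of_forall_increment_le (z := z) (K := ε / (|t| + 1)) (N := N)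
      (fun c hc => (hz c).trans
        (mul_le_mul_of_nonneg_right (hN c hc).le (sub_nonneg.2 (hτ c.le_succ)))) hτ h2 h1
    rw [Real.dist_eq, sub_zero]
    calc _ ≤ _ := h4
      _ < ε / (|t| + 1) * (|t| + 1) := mul_lt_mul_of_pos_left h3 (div_pos hε hpos)
      _ = ε := div_mul_cancel₀ _ hpos.ne'
  simpa using hdiff.add hl

theorem lipschitzWith_of_tendsto_index {τ z : ℕ → ℝ} {U : Filter ℕ} [U.NeBot] {idx : ℝ → ℕ → ℕ}
    {zl : ℝ → ℝ} {K : NNReal} (hz : ∀ m m', |z m' - z m| ≤ K * |τ m' - τ m|)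
    (hidx : ∀ t, Tendsto (fun n => τ (idx t n) - τ n) U (𝓝 t))
    (hzl : ∀ t, Tendsto (fun n => z (idx t n)) U (𝓝 (zl t))) : LipschitzWith K zl :=
  LipschitzWith.of_dist_le_mul fun t u => by
    rw [Real.dist_eq, Real.dist_eq]
    exact le_of_tendsto_of_tendsto ((hzl t).sub (hzl u)).abs
      ((tendsto_clock_sub hidx u t).abs.const_mul _) (Eventually.of_forall fun n => hz _ _)

theorem sum_mul_sum_add_le {X : A1 → ℝ} {Y : A2 → ℝ} {P : A1 → A2 → ℝ} {N : A2 → A1 → ℝ}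
    (hX : ∀ i, 0 ≤ X i) (hX1 : ∑ i, X i = 1) (hY : ∀ j, 0 ≤ Y j) (hY1 : ∑ j, Y j = 1) :
    ∑ i, X i * ∑ j, P i j * Y j + ∑ j, Y j * ∑ i, N j i * X i
      ≤ maxNorm fun i j => P i j + N j i := by
  have h1 : ∑ j, Y j * ∑ i, N j i * X i = ∑ i, X i * ∑ j, N j i * Y j := by
    simp only [mul_sum]
    rw [sum_comm]
    exact sum_congr rfl fun i _ => sum_congr rfl fun j _ => by ring
  rw [h1, ← sum_add_distrib]
  have h2 : ∀ i, X i * ∑ j, P i j * Y j + X i * ∑ j, N j i * Y j ≤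
      X i * maxNorm fun i j => P i j + N j i := by
    intro i
    rw [← mul_add, ← sum_add_distrib]
    refine mul_le_mul_of_nonneg_left ?_ (hX i)
    calc ∑ j, (P i j * Y j + N j i * Y j) ≤ ∑ j, (maxNorm fun i j => P i j + N j i) * Y j :=
          sum_le_sum fun j _ => by
            rw [← add_mul]
            exact mul_le_mul_of_nonneg_right
              ((le_abs_self _).trans (abs_le_maxNorm (fun i j => P i j + N j i) i j)) (hY j)
      _ = _ := by rw [← mul_sum, hY1, mul_one]
  refine (sum_le_sum fun i _ => h2 i).trans ?_
  rw [← sum_mul, hX1, one_mul]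

theorem eventually_sum_best_reply_le {τ ρ : ℕ → ℝ} (hτ : Monotone τ)
    (htop : Tendsto τ atTop atTop) (hstep : Tendsto (fun n => τ (n + 1) - τ n) atTop (𝓝 0))
    (hρ : Tendsto ρ atTop (𝓝 0)) {x : ℕ → A1 → ℝ} {y : ℕ → A2 → ℝ} {a : ℕ → A1} {b : ℕ → A2}
    {P : ℕ → A1 → A2 → ℝ} {N : ℕ → A2 → A1 → ℝ} {M : ℝ}
    (hx : IsReplyPath τ x a fun c i => ∑ j, P c i j * y c j)
    (hy : IsReplyPath τ y b fun c j => ∑ i, N c j i * x c i)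
    (hPM : ∀ c i j, |P c i j| ≤ M) (hNM : ∀ c j i, |N c j i| ≤ M)
    (hP : ∀ c i j, |P (c + 1) i j - P c i j| ≤ ρ c * (τ (c + 1) - τ c))
    (hN : ∀ c j i, |N (c + 1) j i - N c j i| ≤ ρ c * (τ (c + 1) - τ c)) {ε : ℝ} (hε : 0 < ε) :
    ∀ᶠ c in atTop, univ.sup' univ_nonempty (fun i => ∑ j, P c i j * y c j) +
      univ.sup' univ_nonempty (fun j => ∑ i, N c j i * x c i) ≤
      maxNorm (fun i j => P c i j + N c j i) + ε := by
  by_contra hcon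
  rw [not_eventually] at hcon
  have := frequently_iff_neBot.1 hcon
  set U := Ultrafilter.of (atTop ⊓ 𝓟 {c | ¬ (univ.sup' univ_nonempty (fun i => ∑ j, P c i j * y c j) +
      univ.sup' univ_nonempty (fun j => ∑ i, N c j i * x c i) ≤
      maxNorm (fun i j => P c i j + N c j i) + ε)})
  have hUle : (U : Filter ℕ) ≤ _ := Ultrafilter.of_le _
  have hU : (U : Filter ℕ) ≤ atTop := hUle.trans inf_le_left
  have hUε := le_principal_iff.1 (hUle.trans inf_le_right)
  choose idx hidx hidxτ using exists_time_index hτ htop hstep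
  replace hidx : ∀ t, Tendsto (idx t) U atTop := fun t => (hidx t).mono_left hU
  replace hidxτ : ∀ t, Tendsto (fun n => τ (idx t n) - τ n) U (𝓝 t) :=
    fun t => (hidxτ t).mono_left hU
  choose xl hxl using fun (t : ℝ) (i : A1) => exists_tendsto_ultrafilter U
    (z := fun n => x (idx t n) i) (B := 1)
    (fun n => by rw [abs_of_nonneg (hx.nonneg _ _)]; exact hx.le_one _ _)
  choose yl hyl using fun (t : ℝ) (j : A2) => exists_tendsto_ultrafilter U
    (z := fun n => y (idx t n) j) (B := 1)
    (fun n => by rw [abs_of_nonneg (hy.nonneg _ _)]; exact hy.le_one _ _)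
  choose Pl hPl using fun (i : A1) (j : A2) => exists_tendsto_ultrafilter U
    (z := fun n => P n i j) (fun n => hPM n i j)
  choose Nl hNl using fun (j : A2) (i : A1) => exists_tendsto_ultrafilter U
    (z := fun n => N n j i) (fun n => hNM n j i)
  have hPl' : ∀ t i j, Tendsto (fun n => P (idx t n) i j) U (𝓝 (Pl i j)) := fun t i j =>
    tendsto_comp_index_of_drift hU hτ hρ (z := fun n => P n i j) (fun c => hP c i j) (hidx t)
      (hidxτ t) (hPl i j)
  have hNl' : ∀ t j i, Tendsto (fun n => N (idx t n) j i) U (𝓝 (Nl j i)) := fun t j i =>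
    tendsto_comp_index_of_drift hU hτ hρ (z := fun n => N n j i) (fun c => hN c j i) (hidx t)
      (hidxτ t) (hNl j i)
  obtain ⟨R, hR⟩ := hρ.bddAbove_range
  replace hR : ∀ c, ρ c ≤ R := fun c => hR ⟨c, rfl⟩
  have hFP := abs_score_increment_le hy hτ hR hPM hP
  have hFN := abs_score_increment_le hx hτ hR hNM hN
  have hlip : ∀ {z : ℕ → ℝ} {K : ℝ}, (∀ c, |z (c + 1) - z c| ≤ K * (τ (c + 1) - τ c)) →
      ∀ m m', |z m' - z m| ≤ K.toNNReal * |τ m' - τ m| := fun hz m m' =>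
    (abs_sub_le_of_forall_increment_le (N := 0) (fun c _ => hz c) hτ m.zero_le m'.zero_le).trans
      (mul_le_mul_of_nonneg_right (Real.le_coe_toNNReal _) (abs_nonneg _))
  set vP : ℕ → ℝ := fun c => univ.sup' univ_nonempty fun i => ∑ j, P c i j * y c j with hvP
  set vN : ℕ → ℝ := fun c => univ.sup' univ_nonempty fun j => ∑ i, N c j i * x c i with hvN
  set vPl : ℝ → ℝ := fun t => univ.sup' univ_nonempty fun i => ∑ j, Pl i j * yl t j with hvPl
  set vNl : ℝ → ℝ := fun t => univ.sup' univ_nonempty fun j => ∑ i, Nl j i * xl t i with hvNl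
  have hvPt : ∀ t, Tendsto (fun n => vP (idx t n)) U (𝓝 (vPl t)) := fun t =>
    Tendsto.finset_sup'_nhds_apply univ_nonempty fun i _ =>
      tendsto_finsetSum _ fun j _ => (hPl' t i j).mul (hyl t j)
  have hvNt : ∀ t, Tendsto (fun n => vN (idx t n)) U (𝓝 (vNl t)) := fun t =>
    Tendsto.finset_sup'_nhds_apply univ_nonempty fun j _ =>
      tendsto_finsetSum _ fun i _ => (hNl' t j i).mul (hxl t i)
  have hvPK := hlip (z := vP) fun c => abs_sup'_sub_sup'_le (hFP c)
  have hvNK := hlip (z := vN) fun c => abs_sup'_sub_sup'_le (hFN c)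
  have hvPlip := lipschitzWith_of_tendsto_index hvPK hidxτ hvPt
  have hvNlip := lipschitzWith_of_tendsto_index hvNK hidxτ hvNt
  have hxlip : ∀ i, LipschitzWith 1 (fun t => xl t i) := fun i =>
    lipschitzWith_of_tendsto_index (z := fun n => x n i)
      (fun m m' => by simpa using hx.abs_sub_le hτ m m' i) hidxτ (fun t => hxl t i)
  have hylip : ∀ j, LipschitzWith 1 (fun t => yl t j) := fun j =>
    lipschitzWith_of_tendsto_index (z := fun n => y n j)
      (fun m m' => by simpa using hy.abs_sub_le hτ m m' j) hidxτ (fun t => hyl t j)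
  set D := maxNorm fun i j => Pl i j + Nl j i with hD
  have hglip : LipschitzWith _ (fun t => vPl t + vNl t - D) :=
    (hvPlip.add hvNlip).sub (LipschitzWith.const D)
  have hderiv : ∀ᵐ t, ∀ d, HasDerivAt (fun t => vPl t + vNl t - D) d t →
      d ≤ -(vPl t + vNl t - D) := by
    filter_upwards [hvPlip.ae_differentiableAt_real, hvNlip.ae_differentiableAt_real,
      ae_all_iff.2 fun i => (hxlip i).ae_differentiableAt_real,
      ae_all_iff.2 fun j => (hylip j).ae_differentiableAt_real] with t h1 h2 h3 h4 d hd
    have hd' := hd.unique ((h1.hasDerivAt.add h2.hasDerivAt).sub_const D)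
    have h3' := fun i => (h3 i).hasDerivAt
    have h4' := fun j => (h4 j).hasDerivAt
    have e1 := hx.value_deriv_add hτ hidxτ hxl hFP hyl hPl' h3' h4' h1.hasDerivAt
    have e2 := hy.value_deriv_add hτ hidxτ hyl hFN hxl hNl' h4' h3' h2.hasDerivAt
    have e3 := sum_mul_sum_add_le (P := Pl) (N := Nl)
      (fun i => hx.deriv_add_nonneg hτ hidxτ hxl (h3' i)) (hx.sum_deriv_add_eq_one hxl h3')
      (fun j => hy.deriv_add_nonneg hτ hidxτ hyl (h4' j)) (hy.sum_deriv_add_eq_one hyl h4')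
    simp only [hvPl, hvNl, hD] at hd' ⊢
    linarith
  have hbound : ∀ {A B : Type} [Fintype A] [Nonempty A] [Fintype B] (Q : A → B → ℝ) (z : B → ℝ),
      (∀ j, 0 ≤ z j) → (∀ j, z j ≤ 1) →
      univ.sup' univ_nonempty (fun i => ∑ j, Q i j * z j) ≤ ∑ i, ∑ j, |Q i j| := by
    intro A B _ _ _ Q z h0 h1
    refine sup'_le _ _ fun i _ => ?_
    calc ∑ j, Q i j * z j ≤ ∑ j, |Q i j| := sum_le_sum fun j _ => by
          calc Q i j * z j ≤ |Q i j| * z j := mul_le_mul_of_nonneg_right (le_abs_self _) (h0 j)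
            _ ≤ _ := mul_le_of_le_one_right (abs_nonneg _) (h1 j)
      _ ≤ _ := single_le_sum (f := fun i => ∑ j, |Q i j|)
          (fun i _ => sum_nonneg fun j _ => abs_nonneg _) (mem_univ i)
  have hB : ∀ t, vPl t + vNl t - D ≤ ∑ i, ∑ j, |Pl i j| + ∑ j, ∑ i, |Nl j i| - D := by
    intro t
    have b1 := hbound Pl (yl t)
      (fun j => ge_of_tendsto (hyl t j) (Eventually.of_forall fun n => hy.nonneg _ _))
      (fun j => le_of_tendsto (hyl t j) (Eventually.of_forall fun n => hy.le_one _ _))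
    have b2 := hbound Nl (xl t)
      (fun j => ge_of_tendsto (hxl t j) (Eventually.of_forall fun n => hx.nonneg _ _))
      (fun j => le_of_tendsto (hxl t j) (Eventually.of_forall fun n => hx.le_one _ _))
    simp only [hvPl, hvNl]
    linarith
  have hg0 := le_zero_of_deriv_le_neg hglip hderiv hB
  have hback : ∀ {z : ℕ → ℝ} {K l : ℝ}, (∀ m m', |z m' - z m| ≤ K * |τ m' - τ m|) →
      Tendsto (fun n => z (idx 0 n)) U (𝓝 l) → Tendsto z U (𝓝 l) := by
    intro z K l hz hl
    have h1 : Tendsto (fun n => z (idx 0 n) - z n) U (𝓝 0) :=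
      squeeze_zero_norm (fun n => hz _ _) (by simpa using (hidxτ 0).abs.const_mul K)
    simpa using hl.sub h1
  have hlim : Tendsto (fun n => vP n + vN n - maxNorm fun i j => P n i j + N n j i) U
      (𝓝 (vPl 0 + vNl 0 - D)) :=
    ((hback hvPK (hvPt 0)).add (hback hvNK (hvNt 0))).sub
      (tendsto_maxNorm fun i j => (hPl i j).add (hNl j i))
  have hge : ε ≤ vPl 0 + vNl 0 - D := ge_of_tendsto hlim (by
    filter_upwards [hUε] with n hn
    have := not_le.1 hn
    linarith)
  linarith

theorem eventually_le_of_averaging {u σ : ℕ → ℝ} {c δ : ℝ} (hσ1 : ∀ k, σ k ≤ 1)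
    (hsum : Tendsto (fun n => ∑ k ∈ range n, σ k) atTop atTop)
    (hu : ∀ᶠ k in atTop, u (k + 1) ≤ (1 - σ k) * u k + σ k * c) (hδ : 0 < δ) :
    ∀ᶠ k in atTop, u k ≤ c + δ := by
  obtain ⟨N, hN⟩ := eventually_atTop.1 hu
  have key : ∀ n, N ≤ n → u n - c ≤
      Real.exp (-(∑ k ∈ range n, σ k)) * (Real.exp (∑ k ∈ range N, σ k) * |u N - c|) := by
    intro n hn
    induction n, hn using Nat.le_induction with
    | base => rw [← mul_assoc, ← Real.exp_add, neg_add_cancel, Real.exp_zero, one_mul]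
              exact le_abs_self _
    | succ n hn ih =>
      rw [sum_range_succ, neg_add_rev, Real.exp_add, mul_assoc]
      have h1 : u (n + 1) - c ≤ (1 - σ n) * (u n - c) := by linarith [hN n hn]
      have h2 : 1 - σ n ≤ Real.exp (-σ n) := by linarith [Real.add_one_le_exp (-σ n)]
      exact h1.trans ((mul_le_mul_of_nonneg_left ih (by linarith [hσ1 n])).trans
        (mul_le_mul_of_nonneg_right h2 (by positivity)))
  have hlim := (Real.tendsto_exp_neg_atTop_nhds_zero.comp hsum).mul_const
    (Real.exp (∑ k ∈ range N, σ k) * |u N - c|)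
  rw [zero_mul] at hlim
  filter_upwards [hlim.eventually_lt_const hδ, eventually_ge_atTop N] with n h1 h2
  have := key n h2
  simp only [Function.comp_apply] at h1
  linarith

theorem abs_sum_mul_le_of_sum_eq_one {ι : Type*} [Fintype ι] {w p : ι → ℝ} {M : ℝ}
    (hp : ∀ i, 0 ≤ p i) (hp1 : ∑ i, p i = 1) (hw : ∀ i, |w i| ≤ M) : |∑ i, w i * p i| ≤ M :=
  calc |∑ i, w i * p i| ≤ ∑ i, |w i * p i| := abs_sum_le_sum_abs _ _
    _ ≤ ∑ i, M * p i := sum_le_sum fun i _ => by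
      rw [abs_mul, abs_of_nonneg (hp i)]
      exact mul_le_mul_of_nonneg_right (hw i) (hp i)
    _ = M := by rw [← mul_sum, hp1, mul_one]

theorem abs_add_mul_sub_le {q σ z C D : ℝ} (hσ0 : 0 ≤ σ) (hσ1 : σ ≤ 1) (hq : |q| ≤ C)
    (hz : |z| ≤ D) : |q + σ * (z - q)| ≤ (1 - σ) * C + σ * D := by
  rw [show q + σ * (z - q) = (1 - σ) * q + σ * z by ring]
  refine (abs_add_le _ _).trans (add_le_add ?_ ?_)
  · rw [abs_mul, abs_of_nonneg (sub_nonneg.2 hσ1)]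
    exact mul_le_mul_of_nonneg_left hq (sub_nonneg.2 hσ1)
  · rw [abs_mul, abs_of_nonneg hσ0]
    exact mul_le_mul_of_nonneg_left hz hσ0

/-- Asynchronous averaging towards a `γ`-contraction, up to vanishing errors, converges to zero. -/
theorem tendsto_maxNorm_of_asynchronous_contraction {γ : ℝ} (hγ0 : 0 ≤ γ) (hγ1 : γ < 1)
    {p : S → A1 → A2 → S → ℝ} (hp : ∀ s i j s', 0 ≤ p s i j s') (hp1 : ∀ s i j, ∑ s', p s i j s' = 1)
    {σ : S → ℕ → ℝ} (hσ0 : ∀ s k, 0 ≤ σ s k) (hσ1 : ∀ s k, σ s k ≤ 1)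
    (hσ : ∀ s, Tendsto (fun n => ∑ k ∈ range n, σ s k) atTop atTop)
    {W : S → ℕ → A1 → A2 → ℝ} {w : ℕ → S → ℝ} {B : ℝ} (hB : ∀ s k i j, |W s k i j| ≤ B)
    (hW : ∀ s k i j, W s (k + 1) i j =
      W s k i j + σ s k * (γ * ∑ s', w k s' * p s i j s' - W s k i j))
    (hw : ∀ s, ∀ ε > 0, ∀ᶠ k in atTop, |w k s| ≤ maxNorm (W s k) + ε) (s : S) :
    Tendsto (fun k => maxNorm (W s k)) atTop (𝓝 0) := by
  have contract : ∀ M, (∀ᶠ k in atTop, ∀ s, maxNorm (W s k) ≤ M) → ∀ δ > 0,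
      ∀ᶠ k in atTop, ∀ s, maxNorm (W s k) ≤ γ * (M + δ) + δ := by
    intro M hM δ hδ
    refine eventually_all.2 fun s => eventually_le_of_averaging (hσ1 s) (hσ s) ?_ hδ
    filter_upwards [hM, eventually_all.2 fun s => hw s δ hδ] with k h1 h2
    refine maxNorm_le fun i j => ?_
    rw [hW]
    refine abs_add_mul_sub_le (hσ0 s k) (hσ1 s k) (abs_le_maxNorm _ i j) ?_
    rw [abs_mul, abs_of_nonneg hγ0]
    exact mul_le_mul_of_nonneg_left (abs_sum_mul_le_of_sum_eq_one (hp s i j) (hp1 s i j)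
      fun s' => (h2 s').trans (by linarith [h1 s'])) hγ0
  set I : Set ℝ := {M | ∀ᶠ k in atTop, ∀ s, maxNorm (W s k) ≤ M} with hI
  have hI0 : ∀ M ∈ I, 0 ≤ M := fun M hM => by
    obtain ⟨k, hk⟩ := hM.exists
    exact (maxNorm_nonneg _).trans (hk s)
  have hIne : I.Nonempty := ⟨B, Eventually.of_forall fun k s => maxNorm_le (hB s k)⟩
  have hIbdd : BddBelow I := ⟨0, hI0⟩
  have hinf : sInf I ≤ 0 := by
    by_contra! hpos
    have hδ : 0 < (1 - γ) * sInf I / 4 := by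
      have := mul_pos (sub_pos.2 hγ1) hpos
      linarith
    obtain ⟨M, hMI, hM⟩ := exists_lt_of_csInf_lt hIne (lt_add_of_pos_right (sInf I) hδ)
    have h1 := csInf_le hIbdd (contract M hMI _ hδ)
    have h2 := mul_le_mul_of_nonneg_left (add_le_add_left hM.le ((1 - γ) * sInf I / 4)) hγ0
    have h3 := mul_le_mul_of_nonneg_right hγ1.le hδ.le
    linarith
  rw [Metric.tendsto_nhds]
  intro ε hε
  obtain ⟨M, hMI, hM⟩ := exists_lt_of_csInf_lt hIne (hinf.trans_lt hε)
  filter_upwards [hMI] with k hk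
  rw [Real.dist_eq, sub_zero, abs_of_nonneg (maxNorm_nonneg _)]
  exact (hk s).trans_lt hM

theorem exists_forall_abs_le_of_discounted_averaging {γ : ℝ} (hγ0 : 0 ≤ γ) (hγ1 : γ < 1)
    {p : S → A1 → A2 → S → ℝ} (hp : ∀ s i j s', 0 ≤ p s i j s') (hp1 : ∀ s i j, ∑ s', p s i j s' = 1)
    {σ : S → ℕ → ℝ} (hσ0 : ∀ s k, 0 ≤ σ s k) (hσ1 : ∀ s k, σ s k ≤ 1)
    {r : S → A1 → A2 → ℝ} {Q : S → ℕ → A1 → A2 → ℝ} {v : ℕ → S → ℝ} (hQ0 : ∀ s, Q s 0 = r s)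
    (hv : ∀ k s, |v k s| ≤ maxNorm (Q s k))
    (hQ : ∀ s k i j, Q s (k + 1) i j =
      Q s k i j + σ s k * (r s i j + γ * ∑ s', v k s' * p s i j s' - Q s k i j)) :
    ∃ M, (∀ s k i j, |Q s k i j| ≤ M) ∧
      ∀ s k i j, |Q s (k + 1) i j - Q s k i j| ≤ 2 * M * σ s k := by
  obtain ⟨R, hR0, hR⟩ : ∃ R, 0 ≤ R ∧ ∀ s i j, |r s i j| ≤ R :=
    ⟨∑ s, maxNorm (r s), sum_nonneg fun s _ => maxNorm_nonneg _, fun s i j =>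
      (abs_le_maxNorm (r s) i j).trans
        (single_le_sum (f := fun s => maxNorm (r s)) (fun s _ => maxNorm_nonneg _) (mem_univ s))⟩
  have h1γ : 0 < 1 - γ := sub_pos.2 hγ1
  set M := R / (1 - γ) with hM
  have hMR : R + γ * M = M := by rw [hM]; field_simp; ring
  have hRM : R ≤ M := by
    have : 0 ≤ γ * M := mul_nonneg hγ0 (div_nonneg hR0 h1γ.le)
    linarith
  have target : ∀ k, (∀ s i j, |Q s k i j| ≤ M) →
      ∀ s i j, |r s i j + γ * ∑ s', v k s' * p s i j s'| ≤ M := by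
    intro k hk s i j
    refine (abs_add_le _ _).trans ?_
    rw [abs_mul, abs_of_nonneg hγ0, ← hMR]
    exact add_le_add (hR s i j) (mul_le_mul_of_nonneg_left (abs_sum_mul_le_of_sum_eq_one
      (hp s i j) (hp1 s i j) fun s' => (hv k s').trans (maxNorm_le (hk s'))) hγ0)
  have bound : ∀ k s i j, |Q s k i j| ≤ M := by
    intro k
    induction k with
    | zero => intro s i j; rw [hQ0]; exact (hR s i j).trans hRM
    | succ k ih =>
      intro s i j
      rw [hQ]
      refine (abs_add_mul_sub_le (hσ0 s k) (hσ1 s k) (ih s i j) (target k ih s i j)).trans ?_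
      linarith
  refine ⟨M, fun s k => bound k s, fun s k i j => ?_⟩
  rw [hQ, add_sub_cancel_left, abs_mul, abs_of_nonneg (hσ0 s k), mul_comm]
  refine mul_le_mul_of_nonneg_right ((abs_sub _ _).trans ?_) (hσ0 s k)
  linarith [target k (bound k) s i j, bound k s i j]

theorem tendsto_maxNorm_sub_fixed_point {γ : ℝ} (hγ0 : 0 ≤ γ) (hγ1 : γ < 1)
    {p : S → A1 → A2 → S → ℝ} (hp : ∀ s i j s', 0 ≤ p s i j s') (hp1 : ∀ s i j, ∑ s', p s i j s' = 1)
    {σ : S → ℕ → ℝ} (hσ0 : ∀ s k, 0 ≤ σ s k) (hσ1 : ∀ s k, σ s k ≤ 1)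
    (hσ : ∀ s, Tendsto (fun n => ∑ k ∈ range n, σ s k) atTop atTop)
    {r : S → A1 → A2 → ℝ} {Q : S → ℕ → A1 → A2 → ℝ} {v : ℕ → S → ℝ} {M : ℝ}
    (hQM : ∀ s k i j, |Q s k i j| ≤ M)
    (hQ : ∀ s k i j, Q s (k + 1) i j =
      Q s k i j + σ s k * (r s i j + γ * ∑ s', v k s' * p s i j s' - Q s k i j))
    {Qs : S → A1 → A2 → ℝ} {val : (A1 → A2 → ℝ) → ℝ}
    (hval : ∀ Q Q' : A1 → A2 → ℝ, |val Q - val Q'| ≤ maxNorm fun i j => Q i j - Q' i j)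
    (hQs : ∀ s, Qs s = fun i j => r s i j + γ * ∑ s', val (Qs s') * p s i j s')
    (hv : ∀ s, ∀ ε > 0, ∀ᶠ k in atTop, |v k s - val (Q s k)| ≤ ε) (s : S) :
    Tendsto (fun k => maxNorm fun i j => Q s k i j - Qs s i j) atTop (𝓝 0) := by
  refine tendsto_maxNorm_of_asynchronous_contraction hγ0 hγ1 hp hp1 hσ0 hσ1 hσ
    (W := fun s k i j => Q s k i j - Qs s i j) (w := fun k s => v k s - val (Qs s))
    (B := M + ∑ s, maxNorm (Qs s)) ?_ ?_ ?_ s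
  · intro s k i j
    refine (abs_sub _ _).trans (add_le_add (hQM s k i j) ((abs_le_maxNorm (Qs s) i j).trans ?_))
    exact single_le_sum (f := fun s => maxNorm (Qs s)) (fun s _ => maxNorm_nonneg _) (mem_univ s)
  · intro s k i j
    have h1 := congrFun (congrFun (hQs s) i) j
    simp only [sub_mul, sum_sub_distrib, hQ]
    linear_combination (-σ s k) * h1
  · intro s ε hε
    filter_upwards [hv s ε hε] with k hk
    have h1 := abs_sub_le (v k s) (val (Q s k)) (val (Qs s))
    have h2 := hval (Q s k) (Qs s)
    linarith

theorem sum_mul_le_sup' {ι : Type*} [Fintype ι] [Nonempty ι] {x : ι → ℝ} (hx : x ∈ stdSimplex ℝ ι)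
    (f : ι → ℝ) : ∑ i, x i * f i ≤ univ.sup' univ_nonempty f :=
  calc ∑ i, x i * f i ≤ ∑ i, x i * univ.sup' univ_nonempty f :=
        sum_le_sum fun i _ => mul_le_mul_of_nonneg_left (le_sup' f (mem_univ i)) (hx.1 i)
    _ = _ := by rw [← sum_mul, hx.2, one_mul]

theorem neg_maxNorm_le_sup'_add_sup' {x : A1 → ℝ} {y : A2 → ℝ} (hx : x ∈ stdSimplex ℝ A1)
    (hy : y ∈ stdSimplex ℝ A2) (P N : A1 → A2 → ℝ) :
    -(maxNorm fun i j => P i j + N i j) ≤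
      univ.sup' univ_nonempty (fun i => ∑ j, P i j * y j) +
      univ.sup' univ_nonempty (fun j => ∑ i, x i * N i j) := by
  have h1 := sum_mul_le_sup' hx fun i => ∑ j, P i j * y j
  have h2 := sum_mul_le_sup' hy fun j => ∑ i, x i * N i j
  have h3 := sum_mul_sum_add_le (P := fun i j => -P i j) (N := fun j i => -N i j) hx.1 hx.2 hy.1 hy.2
  have h4 : (maxNorm fun i j => -P i j + -N i j) = maxNorm fun i j => P i j + N i j := by
    simp only [maxNorm, ← neg_add, abs_neg]
  simp only [neg_mul, sum_neg_distrib, mul_neg, h4] at h3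
  simp only [mul_comm (x _) (N _ _)] at h2 ⊢
  linarith

theorem abs_sup'_sum_mul_sub_le {y : A2 → ℝ} (hy : y ∈ stdSimplex ℝ A2) (Q Q' : A1 → A2 → ℝ) :
    |univ.sup' univ_nonempty (fun i => ∑ j, Q i j * y j) -
      univ.sup' univ_nonempty (fun i => ∑ j, Q' i j * y j)| ≤
      maxNorm fun i j => Q i j - Q' i j := by
  refine abs_sup'_sub_sup'_le fun i => ?_
  rw [← sum_sub_distrib]
  simp only [← sub_mul]
  exact abs_sum_mul_le_of_sum_eq_one hy.1 hy.2 fun j =>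
    abs_le_maxNorm (fun i j => Q i j - Q' i j) i j

theorem abs_sup'_sum_mul_le {y : A2 → ℝ} (hy : y ∈ stdSimplex ℝ A2) (Q : A1 → A2 → ℝ) :
    |univ.sup' univ_nonempty (fun i => ∑ j, Q i j * y j)| ≤ maxNorm Q := by
  simpa using abs_sup'_sum_mul_sub_le hy Q 0

theorem maxNorm_transpose (Q : A1 → A2 → ℝ) : maxNorm (fun j i => Q i j) = maxNorm Q :=
  le_antisymm (maxNorm_le fun j i => abs_le_maxNorm Q i j)
    (maxNorm_le fun i j => abs_le_maxNorm (fun j i => Q i j) j i)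

theorem val1_le {y : A2 → ℝ} (hy : y ∈ stdSimplex ℝ A2) (Q : A1 → A2 → ℝ) :
    val1 Q ≤ univ.sup' univ_nonempty fun i => ∑ j, Q i j * y j := by
  refine csInf_le ⟨-maxNorm Q, ?_⟩ (Set.mem_image_of_mem _ hy)
  rintro _ ⟨z, hz, rfl⟩
  exact (abs_le.1 (abs_sup'_sum_mul_le hz Q)).1

theorem le_val1 {Q : A1 → A2 → ℝ} {c : ℝ}
    (h : ∀ y ∈ stdSimplex ℝ A2, c ≤ univ.sup' univ_nonempty fun i => ∑ j, Q i j * y j) :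
    c ≤ val1 Q := by
  refine le_csInf (Set.Nonempty.image _ ?_) ?_
  · exact ⟨_, single_mem_stdSimplex ℝ (Classical.arbitrary A2)⟩
  · rintro _ ⟨z, hz, rfl⟩
    exact h z hz

theorem val2_eq_val1_transpose (Q : A1 → A2 → ℝ) : val2 Q = val1 fun j i => Q i j := by
  simp only [val1, val2, mul_comm]

theorem abs_val1_sub_le (Q Q' : A1 → A2 → ℝ) :
    |val1 Q - val1 Q'| ≤ maxNorm fun i j => Q i j - Q' i j := by
  have aux : ∀ Q Q' : A1 → A2 → ℝ, val1 Q - (maxNorm fun i j => Q i j - Q' i j) ≤ val1 Q' :=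
    fun Q Q' => le_val1 fun y hy => by
      have h1 := val1_le hy Q
      have h2 := (abs_le.1 (abs_sup'_sum_mul_sub_le hy Q Q')).2
      linarith
  have h1 := aux Q Q'
  have h2 := aux Q' Q
  have h3 : (maxNorm fun i j => Q' i j - Q i j) = maxNorm fun i j => Q i j - Q' i j := by
    simp only [maxNorm, abs_sub_comm]
  rw [abs_le]
  constructor <;> linarith

theorem abs_val2_sub_le (Q Q' : A1 → A2 → ℝ) :
    |val2 Q - val2 Q'| ≤ maxNorm fun i j => Q i j - Q' i j := by
  rw [val2_eq_val1_transpose, val2_eq_val1_transpose, ← maxNorm_transpose]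
  exact abs_val1_sub_le _ _

theorem val2_le {x : A1 → ℝ} (hx : x ∈ stdSimplex ℝ A1) (Q : A1 → A2 → ℝ) :
    val2 Q ≤ univ.sup' univ_nonempty fun j => ∑ i, x i * Q i j := by
  simpa only [val2_eq_val1_transpose, mul_comm] using val1_le hx fun j i => Q i j

theorem neg_maxNorm_le_val1_add_val2 (P N : A1 → A2 → ℝ) :
    -(maxNorm fun i j => P i j + N i j) ≤ val1 P + val2 N := by
  have h : -(maxNorm fun i j => P i j + N i j) - val1 P ≤ val2 N := by
    rw [val2_eq_val1_transpose]
    refine le_val1 fun x hx => ?_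
    suffices -(maxNorm fun i j => P i j + N i j) -
        univ.sup' univ_nonempty (fun j => ∑ i, N i j * x i) ≤ val1 P by linarith
    refine le_val1 fun y hy => ?_
    have := neg_maxNorm_le_sup'_add_sup' hx hy P N
    simp only [mul_comm (x _) (N _ _)] at this
    linarith
  linarith

namespace MBFP

/-- The step size `f c` used at stage `k` in state `s` at its visit number `c`, and zero if `s` is
not visited at stage `k`. -/
noncomputable def visitStep (G : MBFP S A1 A2) (f : ℕ → ℝ) (s : S) (k : ℕ) : ℝ :=
  if s = G.st k then f (G.cnt s k) else 0

theorem sum_visitStep (G : MBFP S A1 A2) (f : ℕ → ℝ) (s : S) (n : ℕ) :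
    ∑ k ∈ range n, G.visitStep f s k = ∑ c ∈ range (G.cnt s n), f c := by
  induction n with
  | zero => simp [cnt]
  | succ n ih =>
    rw [sum_range_succ, ih, visitStep]
    by_cases hs : s = G.st n
    · have : G.cnt s (n + 1) = G.cnt s n + 1 := by
        simp [cnt, range_add_one, filter_insert, hs.symm]
      rw [this, sum_range_succ, if_pos hs]
    · have : G.cnt s (n + 1) = G.cnt s n := by
        simp [cnt, range_add_one, filter_insert, Ne.symm hs]
      rw [this, if_neg hs, add_zero]

theorem visitStep_nonneg (G : MBFP S A1 A2) {f : ℕ → ℝ} (hf : ∀ c, f c ∈ Set.Ioc (0 : ℝ) 1)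
    (s : S) (k : ℕ) : 0 ≤ G.visitStep f s k := by
  rw [visitStep]; split_ifs
  exacts [(hf _).1.le, le_rfl]

theorem visitStep_le_one (G : MBFP S A1 A2) {f : ℕ → ℝ} (hf : ∀ c, f c ∈ Set.Ioc (0 : ℝ) 1)
    (s : S) (k : ℕ) : G.visitStep f s k ≤ 1 := by
  rw [visitStep]; split_ifs
  exacts [(hf _).2, zero_le_one]

theorem Q1_succ (G : MBFP S A1 A2) (s : S) (k : ℕ) (i : A1) (j : A2) : G.Q1 s (k + 1) i j =
    G.Q1 s k i j + G.visitStep G.β s k *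
      (G.r1 s i j + G.γ * ∑ s', G.vhat1 k s' * G.p s i j s' - G.Q1 s k i j) := by
  rw [G.Q1_upd]; rfl

theorem Q2_succ (G : MBFP S A1 A2) (s : S) (k : ℕ) (i : A1) (j : A2) : G.Q2 s (k + 1) i j =
    G.Q2 s k i j + G.visitStep G.β s k *
      (G.r2 s i j + G.γ * ∑ s', G.vhat2 k s' * G.p s i j s' - G.Q2 s k i j) := by
  rw [G.Q2_upd]; rfl

theorem abs_vhat1_le (G : MBFP S A1 A2) (k : ℕ) (s : S) : |G.vhat1 k s| ≤ maxNorm (G.Q1 s k) :=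
  abs_sup'_sum_mul_le (G.π2_simplex s k) _

theorem abs_vhat2_le (G : MBFP S A1 A2) (k : ℕ) (s : S) : |G.vhat2 k s| ≤ maxNorm (G.Q2 s k) := by
  have := abs_sup'_sum_mul_le (G.π1_simplex s k) fun j i => G.Q2 s k i j
  rw [maxNorm_transpose] at this
  simpa only [vhat2, mul_comm] using this

theorem eventually_vhat1_add_vhat2_le (G : MBFP S A1 A2) (h : G.Assumption1) {M : ℝ}
    (hQ1 : ∀ s k i j, |G.Q1 s k i j| ≤ M) (hQ2 : ∀ s k i j, |G.Q2 s k i j| ≤ M)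
    (hd1 : ∀ s k i j, |G.Q1 s (k + 1) i j - G.Q1 s k i j| ≤ 2 * M * G.visitStep G.β s k)
    (hd2 : ∀ s k i j, |G.Q2 s (k + 1) i j - G.Q2 s k i j| ≤ 2 * M * G.visitStep G.β s k)
    (s : S) {ε : ℝ} (hε : 0 < ε) :
    ∀ᶠ k in atTop, G.vhat1 k s + G.vhat2 k s ≤
      maxNorm (fun i j => G.Q1 s k i j + G.Q2 s k i j) + ε := by
  obtain ⟨hcnt, hα, -, hα0, -, hβα⟩ := h
  have hinc : ∀ n, ∑ k ∈ range (n + 1), G.visitStep G.α s k - ∑ k ∈ range n, G.visitStep G.α s k =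
      G.visitStep G.α s n := fun n => by rw [sum_range_succ, add_sub_cancel_left]
  have hvisit : ∀ n, ∑ k ∈ range (n + 1), G.visitStep G.α s k ≠
      ∑ k ∈ range n, G.visitStep G.α s k → s = G.st n := by
    intro n hn
    by_contra hs
    exact hn (sub_eq_zero.1 ((hinc n).trans (if_neg hs)))
  have hdrift : ∀ c, 2 * M * G.visitStep G.β s c = 2 * M * (G.β (G.cnt s c) / G.α (G.cnt s c)) *
      (∑ k ∈ range (c + 1), G.visitStep G.α s k - ∑ k ∈ range c, G.visitStep G.α s k) := by
    intro c
    rw [hinc, visitStep, visitStep]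
    split_ifs
    · rw [mul_assoc (2 * M) (_ / _), div_mul_cancel₀ _ (G.α_mem _).1.ne']
    · simp
  have hx : IsReplyPath (fun n => ∑ k ∈ range n, G.visitStep G.α s k) (G.π1 s) G.astar1
      fun c i => ∑ j, G.Q1 s c i j * G.π2 s c j := by
    refine ⟨G.π1_simplex s, fun k i => ?_, fun k hk i => ?_⟩
    · rw [hinc, G.π1_upd]; rfl
    · obtain rfl := hvisit k hk
      exact G.astar1_br k i
  have hy : IsReplyPath (fun n => ∑ k ∈ range n, G.visitStep G.α s k) (G.π2 s) G.astar2
      fun c j => ∑ i, G.Q2 s c i j * G.π1 s c i := by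
    refine ⟨G.π2_simplex s, fun k i => ?_, fun k hk i => ?_⟩
    · rw [hinc, G.π2_upd]; rfl
    · obtain rfl := hvisit k hk
      simpa only [mul_comm] using G.astar2_br k i
  have key := eventually_sum_best_reply_le
    (τ := fun n => ∑ k ∈ range n, G.visitStep G.α s k)
    (ρ := fun c => 2 * M * (G.β (G.cnt s c) / G.α (G.cnt s c)))
    (monotone_nat_of_le_succ fun n =>
      sub_nonneg.1 ((hinc n).symm ▸ G.visitStep_nonneg G.α_mem s n))
    (by simp only [sum_visitStep]; exact hα.comp (hcnt s))
    (by
      simp only [hinc]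
      refine squeeze_zero (G.visitStep_nonneg G.α_mem s) (fun n => ?_) (hα0.comp (hcnt s))
      rw [visitStep]; split_ifs
      exacts [le_rfl, (G.α_mem _).1.le])
    (by simpa using (hβα.comp (hcnt s)).const_mul (2 * M))
    hx hy (hQ1 s) (fun c j i => hQ2 s c i j)
    (fun c i j => (hd1 s c i j).trans_eq (hdrift c))
    (fun c j i => (hd2 s c i j).trans_eq (hdrift c)) hε
  simpa only [vhat1, vhat2, mul_comm (G.π1 _ _ _)] using key

end MBFP

/-- Lemma 7 of Sayin–Parise–Ozdaglar: the beliefs on `Q`-functions converge to the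
(unique) fixed points of the Shapley operators. -/
theorem q_beliefs_converge_to_fixed_point (G : MBFP S A1 A2) (h : G.Assumption1)
    (Qstar1 Qstar2 : S → A1 → A2 → ℝ)
    (hfix1 : ∀ s, Qstar1 s = fun b1 b2 =>
      G.r1 s b1 b2 + G.γ * ∑ s', val1 (Qstar1 s') * G.p s b1 b2 s')
    (hfix2 : ∀ s, Qstar2 s = fun b1 b2 =>
      G.r2 s b1 b2 + G.γ * ∑ s', val2 (Qstar2 s') * G.p s b1 b2 s')
    (s : S) :
    Tendsto (fun k => maxNorm (fun b1 b2 => G.Q1 s k b1 b2 - Qstar1 s b1 b2)) atTop (𝓝 0) ∧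
    Tendsto (fun k => maxNorm (fun b1 b2 => G.Q2 s k b1 b2 - Qstar2 s b1 b2)) atTop (𝓝 0) := by
  obtain ⟨M1, hM1, hd1⟩ := exists_forall_abs_le_of_discounted_averaging G.γ_nonneg G.γ_lt_one
    G.p_nonneg G.p_sum_one (G.visitStep_nonneg G.β_mem) (G.visitStep_le_one G.β_mem) G.Q1_init
    G.abs_vhat1_le G.Q1_succ
  obtain ⟨M2, hM2, hd2⟩ := exists_forall_abs_le_of_discounted_averaging G.γ_nonneg G.γ_lt_one
    G.p_nonneg G.p_sum_one (G.visitStep_nonneg G.β_mem) (G.visitStep_le_one G.β_mem) G.Q2_init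
    G.abs_vhat2_le G.Q2_succ
  have hσ : ∀ s, Tendsto (fun n => ∑ k ∈ range n, G.visitStep G.β s k) atTop atTop := fun s => by
    simp only [MBFP.sum_visitStep]
    exact h.2.2.1.comp (h.1 s)
  have hup : ∀ s, ∀ ε > 0, ∀ᶠ k in atTop, G.vhat1 k s + G.vhat2 k s ≤
      maxNorm (fun i j => G.Q1 s k i j + G.Q2 s k i j) + ε := fun s ε hε =>
    G.eventually_vhat1_add_vhat2_le h (M := max M1 M2)
      (fun s k i j => (hM1 s k i j).trans (le_max_left _ _))
      (fun s k i j => (hM2 s k i j).trans (le_max_right _ _))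
      (fun s k i j => (hd1 s k i j).trans (mul_le_mul_of_nonneg_right
        (mul_le_mul_of_nonneg_left (le_max_left _ _) zero_le_two)
        (G.visitStep_nonneg G.β_mem s k)))
      (fun s k i j => (hd2 s k i j).trans (mul_le_mul_of_nonneg_right
        (mul_le_mul_of_nonneg_left (le_max_right _ _) zero_le_two)
        (G.visitStep_nonneg G.β_mem s k))) s hε
  have hsum : ∀ s, Tendsto (fun k => maxNorm fun i j => G.Q1 s k i j + G.Q2 s k i j) atTop (𝓝 0) :=
    tendsto_maxNorm_of_asynchronous_contraction G.γ_nonneg G.γ_lt_one G.p_nonneg G.p_sum_one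
      (G.visitStep_nonneg G.β_mem) (G.visitStep_le_one G.β_mem) hσ
      (W := fun s k i j => G.Q1 s k i j + G.Q2 s k i j) (w := fun k s => G.vhat1 k s + G.vhat2 k s)
      (B := M1 + M2)
      (fun s k i j => (abs_add_le _ _).trans (add_le_add (hM1 s k i j) (hM2 s k i j)))
      (fun s k i j => by
        simp only [G.Q1_succ, G.Q2_succ, add_mul, sum_add_distrib]
        linear_combination G.visitStep G.β s k * G.zerosum s i j)
      (fun s ε hε => by
        filter_upwards [hup s ε hε] with k hk
        have hlow : -(maxNorm fun i j => G.Q1 s k i j + G.Q2 s k i j) ≤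
            G.vhat1 k s + G.vhat2 k s :=
          neg_maxNorm_le_sup'_add_sup' (G.π1_simplex s k) (G.π2_simplex s k) _ _
        exact abs_le.2 ⟨by linarith, hk⟩)
  have hgap : ∀ s, ∀ ε > 0, ∀ᶠ k in atTop,
      |G.vhat1 k s - val1 (G.Q1 s k)| ≤ ε ∧ |G.vhat2 k s - val2 (G.Q2 s k)| ≤ ε := by
    intro s ε hε
    filter_upwards [hup s (ε / 3) (by positivity),
      (hsum s).eventually_lt_const (show 0 < ε / 3 by positivity)] with k h1 h2
    have h3 : val1 (G.Q1 s k) ≤ G.vhat1 k s := val1_le (G.π2_simplex s k) _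
    have h4 : val2 (G.Q2 s k) ≤ G.vhat2 k s := val2_le (G.π1_simplex s k) _
    have h5 := neg_maxNorm_le_val1_add_val2 (G.Q1 s k) (G.Q2 s k)
    rw [abs_of_nonneg (sub_nonneg.2 h3), abs_of_nonneg (sub_nonneg.2 h4)]
    constructor <;> linarith
  exact ⟨tendsto_maxNorm_sub_fixed_point G.γ_nonneg G.γ_lt_one G.p_nonneg G.p_sum_one
      (G.visitStep_nonneg G.β_mem) (G.visitStep_le_one G.β_mem) hσ hM1 G.Q1_succ abs_val1_sub_le
      hfix1 (fun s ε hε => (hgap s ε hε).mono fun k hk => hk.1) s,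
    tendsto_maxNorm_sub_fixed_point G.γ_nonneg G.γ_lt_one G.p_nonneg G.p_sum_one
      (G.visitStep_nonneg G.β_mem) (G.visitStep_le_one G.β_mem) hσ hM2 G.Q2_succ abs_val2_sub_le
      hfix2 (fun s ε hε => (hgap s ε hε).mono fun k hk => hk.2) s⟩
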